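/- arXiv:0803.1652 — 2 statements merged into one kernel-verified Lean document; each statement's English description precedes it below -/
import Mathlib

section
/- Let δ > 0 and 0 ≤ κ < δ. There is a constant C = C(δ, κ) > 0 with the following property: for every complex Hilbert space H, every bounded self-adjoint operator D on H whose spectrum is disjoint from (−δ, δ), and every bounded operator K on H with ‖K‖ ≤ κ, the operator D + K − iη·Id is invertible for every η ∈ ℝ, and for every φ ∈ H one has ∫_ℝ ‖ |D|^{1/2} (D + K − iη)⁻¹ φ ‖² dη ≤ C ‖φ‖². -/
open MeasureTheory

lemma div_sq_add_sq_eq {c : ℝ} (hc : 0 < c) (x : ℝ) :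
    c / (c ^ 2 + x ^ 2) = c⁻¹ * (1 + (x / c) ^ 2)⁻¹ := by
  field_simp

lemma integrable_div_sq_add_sq {c : ℝ} (hc : 0 < c) :
    Integrable fun x : ℝ ↦ c / (c ^ 2 + x ^ 2) := by
  simp_rw [div_sq_add_sq_eq hc]
  exact (integrable_inv_one_add_sq.comp_div hc.ne').const_mul _

lemma integral_univ_div_sq_add_sq {c : ℝ} (hc : 0 < c) :
    ∫ x : ℝ, c / (c ^ 2 + x ^ 2) = Real.pi := by
  simp_rw [div_sq_add_sq_eq hc]
  rw [integral_const_mul, Measure.integral_comp_div (fun x : ℝ ↦ (1 + x ^ 2)⁻¹) c,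
    integral_univ_inv_one_add_sq, abs_of_pos hc, smul_eq_mul, inv_mul_cancel_left₀ hc.ne']

lemma Commute.add_smul_one_mul_mul_sub_smul_one {R A : Type*} [CommRing R] [Ring A] [Algebra R A]
    {d g : A} (h : Commute d g) (z : R) :
    (d + z • (1 : A)) * g * (d - z • (1 : A)) = g * (d ^ 2 - z ^ 2 • (1 : A)) := by
  simp only [add_mul, mul_sub, smul_mul_assoc, mul_smul_comm, one_mul, mul_one, smul_add, smul_smul,
    h.eq, mul_assoc, pow_two]
  abel

section Resolvent

open Complex

variable {H : Type*} [NormedAddCommGroup H] [InnerProductSpace ℂ H]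

lemma ContinuousLinearMap.IsPositive.re_inner_sub_le {G : H →L[ℂ] H} (hG : G.IsPositive)
    (a b : H) :
    (inner ℂ (a - b) (G (a - b))).re ≤ 2 * (inner ℂ a (G a)).re + 2 * (inner ℂ b (G b)).re := by
  have h : 0 ≤ (inner ℂ (a + b) (G (a + b))).re := hG.re_inner_nonneg_right (a + b)
  simp only [map_add, map_sub, inner_add_left, inner_add_right, inner_sub_left, inner_sub_right,
    add_re, sub_re] at h ⊢
  linarith

variable [CompleteSpace H] {D : H →L[ℂ] H} {δ : ℝ}

lemma re_inner_cfc_le (D : H →L[ℂ] H) {f : ℝ → ℝ} {c : ℝ} (hc : 0 ≤ c)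
    (h : ∀ x ∈ spectrum ℝ D, |f x| ≤ c) (χ : H) :
    (inner ℂ χ (cfc f D χ)).re ≤ c * ‖χ‖ ^ 2 := by
  have hn : ‖cfc f D‖ ≤ c := norm_cfc_le hc h
  calc (inner ℂ χ (cfc f D χ)).re ≤ ‖χ‖ * ‖cfc f D χ‖ := re_inner_le_norm (𝕜 := ℂ) _ _
    _ ≤ ‖χ‖ * (c * ‖χ‖) := by gcongr; exact (cfc f D).le_of_opNorm_le hn χ
    _ = c * ‖χ‖ ^ 2 := by ring

lemma norm_cfc_sqrt_abs_sq (D : H →L[ℂ] H) (ψ : H) :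
    ‖cfc (fun x : ℝ ↦ √|x|) D ψ‖ ^ 2 = (inner ℂ ψ (cfc (fun x : ℝ ↦ |x|) D ψ)).re := by
  have hadj : ContinuousLinearMap.adjoint (cfc (fun x : ℝ ↦ √|x|) D) =
      cfc (fun x : ℝ ↦ √|x|) D := (cfc_predicate (fun x : ℝ ↦ √|x|) D).star_eq
  have hmul : cfc (fun x : ℝ ↦ |x|) D = cfc (fun x : ℝ ↦ √|x|) D * cfc (fun x : ℝ ↦ √|x|) D := by
    rw [← cfc_mul (fun x : ℝ ↦ √|x|) (fun x : ℝ ↦ √|x|) D]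
    simp
  rw [hmul, mul_apply_eq_comp, ← ContinuousLinearMap.adjoint_inner_left, hadj]
  exact (inner_self_eq_norm_sq (𝕜 := ℂ) _).symm

lemma sq_add_sq_pos_of_le_abs (hδ : 0 < δ) {x : ℝ} (hx : δ ≤ |x|) (η : ℝ) :
    0 < x ^ 2 + η ^ 2 := by
  have : 0 < x ^ 2 := sq_pos_of_ne_zero (abs_pos.mp (hδ.trans_le hx))
  positivity

lemma continuousOn_inv_sq_add_sq (hδ : 0 < δ) {s : Set ℝ} (hs : ∀ x ∈ s, δ ≤ |x|) (η : ℝ) :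
    ContinuousOn (fun x : ℝ ↦ (x ^ 2 + η ^ 2)⁻¹) s :=
  ContinuousOn.inv₀ (by fun_prop) fun x hx ↦ (sq_add_sq_pos_of_le_abs hδ (hs x hx) η).ne'

lemma continuousOn_uncurry_abs_div_sq_add_sq (hδ : 0 < δ) {s : Set ℝ} (hs : ∀ x ∈ s, δ ≤ |x|) :
    ContinuousOn (Function.uncurry fun η x : ℝ ↦ |x| / (x ^ 2 + η ^ 2)) (Set.univ ×ˢ s) :=
  ContinuousOn.div (by fun_prop) (by fun_prop) fun p hp ↦
    (sq_add_sq_pos_of_le_abs hδ (hs p.2 hp.2) p.1).ne'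

lemma exists_abs_div_sq_add_sq_le (D : H →L[ℂ] H) (hδ : 0 < δ)
    (hs : ∀ x ∈ spectrum ℝ D, δ ≤ |x|) :
    ∃ M : ℝ, ∀ η : ℝ, ∀ x ∈ spectrum ℝ D,
      ‖|x| / (x ^ 2 + η ^ 2)‖ ≤ M * (δ / (δ ^ 2 + η ^ 2)) := by
  obtain ⟨M, hM⟩ := (spectrum.isCompact (𝕜 := ℝ) D).isBounded.exists_norm_le
  refine ⟨M / δ, fun η x hx ↦ ?_⟩
  have hMx : |x| ≤ M := hM x hx
  have hx' := hs x hx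
  rw [Real.norm_of_nonneg (by positivity), div_mul_div_cancel₀ hδ.ne']
  have hM0 : 0 ≤ M := (abs_nonneg x).trans hMx
  rw [← sq_abs x]
  gcongr

namespace IsSelfAdjoint

lemma add_mul_cfc_mul_sub (hD : IsSelfAdjoint D) (η : ℝ) {f : ℝ → ℝ}
    (hf : ContinuousOn f (spectrum ℝ D)) :
    (D + ((η : ℂ) * I) • (1 : H →L[ℂ] H)) * cfc f D * (D - ((η : ℂ) * I) • (1 : H →L[ℂ] H)) =
      cfc (fun x ↦ f x * (x ^ 2 + η ^ 2)) D := by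
  have hcomm : Commute D (cfc f D) := by
    simpa only [cfc_id' ℝ D] using cfc_commute_cfc (fun x : ℝ ↦ x) f D
  have hsq : cfc (fun x : ℝ ↦ x ^ 2 + η ^ 2) D = D ^ 2 - (((η : ℂ) * I) ^ 2) • (1 : H →L[ℂ] H) := by
    rw [cfc_add_const (η ^ 2) (fun x : ℝ ↦ x ^ 2) D, cfc_pow_id D 2, Algebra.algebraMap_eq_smul_one]
    ext x
    simp [mul_pow, ← Complex.coe_smul]
  rw [cfc_mul f (fun x : ℝ ↦ x ^ 2 + η ^ 2) D, hsq]
  exact hcomm.add_smul_one_mul_mul_sub_smul_one _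

lemma inner_sub_smul_cfc (hD : IsSelfAdjoint D) (η : ℝ) {f : ℝ → ℝ}
    (hf : ContinuousOn f (spectrum ℝ D)) (ψ : H) :
    inner ℂ ((D - ((η : ℂ) * I) • (1 : H →L[ℂ] H)) ψ)
        (cfc f D ((D - ((η : ℂ) * I) • (1 : H →L[ℂ] H)) ψ)) =
      inner ℂ ψ (cfc (fun x ↦ f x * (x ^ 2 + η ^ 2)) D ψ) := by
  have hadj : ContinuousLinearMap.adjoint (D - ((η : ℂ) * I) • (1 : H →L[ℂ] H)) =
      D + ((η : ℂ) * I) • (1 : H →L[ℂ] H) := by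
    rw [← ContinuousLinearMap.star_eq_adjoint, star_sub, star_smul, star_one, hD.star_eq]
    simp [sub_eq_add_neg]
  rw [← ContinuousLinearMap.adjoint_inner_right, hadj, ← hD.add_mul_cfc_mul_sub η hf]
  rfl

lemma add_mul_cfc_inv_mul_sub (hD : IsSelfAdjoint D) (hδ : 0 < δ)
    (hs : ∀ x ∈ spectrum ℝ D, δ ≤ |x|) (η : ℝ) :
    (D + ((η : ℂ) * I) • (1 : H →L[ℂ] H)) * cfc (fun x : ℝ ↦ (x ^ 2 + η ^ 2)⁻¹) D *
      (D - ((η : ℂ) * I) • (1 : H →L[ℂ] H)) = 1 := by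
  rw [hD.add_mul_cfc_mul_sub η (continuousOn_inv_sq_add_sq hδ hs η), ← cfc_const_one ℝ D]
  exact cfc_congr fun x hx ↦ inv_mul_cancel₀ (sq_add_sq_pos_of_le_abs hδ (hs x hx) η).ne'

lemma isUnit_sub_smul_one (hD : IsSelfAdjoint D) (hδ : 0 < δ)
    (hs : ∀ x ∈ spectrum ℝ D, δ ≤ |x|) (η : ℝ) :
    IsUnit (D - ((η : ℂ) * I) • (1 : H →L[ℂ] H)) := by
  have h₁ := hD.add_mul_cfc_inv_mul_sub hδ hs η
  have h₂ := hD.add_mul_cfc_inv_mul_sub hδ hs (-η)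
  simp only [ofReal_neg, neg_mul, neg_smul, sub_neg_eq_add, ← sub_eq_add_neg, neg_sq] at h₂
  rw [mul_assoc] at h₂
  rw [isUnit_iff_exists]
  refine ⟨_, h₂, ?_⟩
  rwa [← left_inv_eq_right_inv h₁ h₂]

lemma le_norm_sub_smul_one_sq (hD : IsSelfAdjoint D) (hδ : 0 < δ)
    (hs : ∀ x ∈ spectrum ℝ D, δ ≤ |x|) (η : ℝ) (ψ : H) :
    (δ ^ 2 + η ^ 2) * ‖ψ‖ ^ 2 ≤ ‖(D - ((η : ℂ) * I) • (1 : H →L[ℂ] H)) ψ‖ ^ 2 := by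
  have hinner := hD.inner_sub_smul_cfc η (continuousOn_inv_sq_add_sq hδ hs η) ψ
  have hone : cfc (fun x : ℝ ↦ (x ^ 2 + η ^ 2)⁻¹ * (x ^ 2 + η ^ 2)) D = 1 := by
    rw [← cfc_const_one ℝ D]
    exact cfc_congr fun x hx ↦ inv_mul_cancel₀ (sq_add_sq_pos_of_le_abs hδ (hs x hx) η).ne'
  have hle := re_inner_cfc_le D (f := fun x : ℝ ↦ (x ^ 2 + η ^ 2)⁻¹) (c := (δ ^ 2 + η ^ 2)⁻¹)
    (by positivity) (fun x hx ↦ by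
      rw [abs_of_nonneg (by positivity), ← sq_abs x]
      have := hs x hx
      gcongr) ((D - ((η : ℂ) * I) • (1 : H →L[ℂ] H)) ψ)
  have hself : (inner ℂ ψ ψ : ℂ).re = ‖ψ‖ ^ 2 := inner_self_eq_norm_sq (𝕜 := ℂ) ψ
  rw [hinner, hone, one_apply_eq_self, hself] at hle
  have hpos : 0 < δ ^ 2 + η ^ 2 := by positivity
  rwa [inv_mul_eq_div, le_div_iff₀' hpos] at hle

lemma isUnit_add_sub_smul_one (hD : IsSelfAdjoint D) (hδ : 0 < δ)
    (hs : ∀ x ∈ spectrum ℝ D, δ ≤ |x|) {K : H →L[ℂ] H} (hK : ‖K‖ < δ) (η : ℝ) :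
    IsUnit (D + K - ((η : ℂ) * I) • (1 : H →L[ℂ] H)) := by
  obtain ⟨u, hu⟩ := hD.isUnit_sub_smul_one hδ hs η
  have hinv : ‖(↑u⁻¹ : H →L[ℂ] H)‖ ≤ δ⁻¹ := by
    refine ContinuousLinearMap.opNorm_le_bound _ (by positivity) fun φ ↦ ?_
    have h := hD.le_norm_sub_smul_one_sq hδ hs η ((↑u⁻¹ : H →L[ℂ] H) φ)
    rw [← hu, ← mul_apply_eq_comp, u.mul_inv, one_apply_eq_self] at h
    rw [inv_mul_eq_div, le_div_iff₀' hδ]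
    refine abs_le_of_sq_le_sq' ?_ (norm_nonneg _) |>.2
    nlinarith [mul_nonneg (sq_nonneg η) (sq_nonneg ‖(↑u⁻¹ : H →L[ℂ] H) φ‖)]
  have hlt : ‖-((↑u⁻¹ : H →L[ℂ] H) * K)‖ < 1 := by
    rw [norm_neg]
    calc ‖(↑u⁻¹ : H →L[ℂ] H) * K‖ ≤ ‖(↑u⁻¹ : H →L[ℂ] H)‖ * ‖K‖ := norm_mul_le _ _
      _ ≤ δ⁻¹ * ‖K‖ := by gcongr
      _ < δ⁻¹ * δ := by gcongr
      _ = 1 := inv_mul_cancel₀ hδ.ne'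
  have hfactor : D + K - ((η : ℂ) * I) • (1 : H →L[ℂ] H) =
      u * (1 - -((↑u⁻¹ : H →L[ℂ] H) * K)) := by
    rw [sub_neg_eq_add, mul_add, mul_one, u.mul_inv_cancel_left, hu]
    abel
  rw [hfactor]
  exact u.isUnit.mul (isUnit_one_sub_of_norm_lt_one hlt)

lemma norm_sq_le_of_add_sub_smul_one (hD : IsSelfAdjoint D) (hδ : 0 < δ)
    (hs : ∀ x ∈ spectrum ℝ D, δ ≤ |x|) {K : H →L[ℂ] H} {κ : ℝ} (hK : ‖K‖ ≤ κ) (hκ : κ < δ)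
    (η : ℝ) (ψ : H) :
    ‖ψ‖ ^ 2 ≤ δ ^ 2 / (δ - κ) ^ 2 * (δ ^ 2 + η ^ 2)⁻¹ *
      ‖(D + K - ((η : ℂ) * I) • (1 : H →L[ℂ] H)) ψ‖ ^ 2 := by
  set φ := (D + K - ((η : ℂ) * I) • (1 : H →L[ℂ] H)) ψ with hφ
  set χ := (D - ((η : ℂ) * I) • (1 : H →L[ℂ] H)) ψ with hχ
  have hκ0 : 0 ≤ κ := (norm_nonneg K).trans hK
  have hsplit : χ = φ - K ψ := by
    simp only [hχ, hφ, sub_apply, add_apply]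
    abel
  have hpos : 0 < δ ^ 2 + η ^ 2 := by positivity
  set t := √(δ ^ 2 + η ^ 2) with ht
  have ht2 : t ^ 2 = δ ^ 2 + η ^ 2 := Real.sq_sqrt hpos.le
  have ht0 : 0 < t := Real.sqrt_pos.mpr hpos
  have hδt : δ ≤ t := Real.le_sqrt_of_sq_le (by nlinarith [sq_nonneg η])
  have hlow : t * ‖ψ‖ ≤ ‖χ‖ := by
    refine abs_le_of_sq_le_sq' ?_ (norm_nonneg _) |>.2
    rw [mul_pow, ht2]
    exact hD.le_norm_sub_smul_one_sq hδ hs η ψ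
  have hup : ‖χ‖ ≤ ‖φ‖ + κ * ‖ψ‖ := by
    rw [hsplit]
    exact (norm_sub_le _ _).trans (by gcongr; exact K.le_of_opNorm_le hK ψ)
  have hmain : (δ - κ) * t * ‖ψ‖ ≤ δ * ‖φ‖ := by
    nlinarith [mul_nonneg (mul_nonneg hκ0 (sub_nonneg.mpr hδt)) (norm_nonneg ψ)]
  have hsq : ((δ - κ) * t * ‖ψ‖) ^ 2 ≤ (δ * ‖φ‖) ^ 2 := by
    have := sub_pos.mpr hκ
    gcongr
  have hδκ : 0 < (δ - κ) ^ 2 := pow_pos (sub_pos.mpr hκ) 2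
  rw [← ht2, div_mul_eq_mul_div, div_mul_eq_mul_div, le_div_iff₀ hδκ, ← div_eq_mul_inv,
    div_mul_eq_mul_div, le_div_iff₀ (by positivity)]
  linarith

lemma integrable_cfc_abs_div (hD : IsSelfAdjoint D) (hδ : 0 < δ)
    (hs : ∀ x ∈ spectrum ℝ D, δ ≤ |x|) :
    Integrable fun η : ℝ ↦ cfc (fun x : ℝ ↦ |x| / (x ^ 2 + η ^ 2)) D := by
  obtain ⟨M, hM⟩ := exists_abs_div_sq_add_sq_le D hδ hs
  exact integrable_cfc _ _ D (continuousOn_uncurry_abs_div_sq_add_sq hδ hs)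
    (.of_forall hM) ((integrable_div_sq_add_sq hδ).const_mul M).hasFiniteIntegral

lemma integral_cfc_abs_div (hD : IsSelfAdjoint D) (hδ : 0 < δ)
    (hs : ∀ x ∈ spectrum ℝ D, δ ≤ |x|) :
    ∫ η : ℝ, cfc (fun x : ℝ ↦ |x| / (x ^ 2 + η ^ 2)) D = Real.pi • (1 : H →L[ℂ] H) := by
  obtain ⟨M, hM⟩ := exists_abs_div_sq_add_sq_le D hδ hs
  rw [← cfc_integral _ _ D (continuousOn_uncurry_abs_div_sq_add_sq hδ hs)
    (.of_forall hM) ((integrable_div_sq_add_sq hδ).const_mul M).hasFiniteIntegral,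
    ← Algebra.algebraMap_eq_smul_one, ← cfc_const Real.pi D]
  refine cfc_congr fun x hx ↦ ?_
  simpa only [sq_abs] using integral_univ_div_sq_add_sq (hδ.trans_le (hs x hx))

lemma integrable_re_inner_cfc_abs_div (hD : IsSelfAdjoint D) (hδ : 0 < δ)
    (hs : ∀ x ∈ spectrum ℝ D, δ ≤ |x|) (φ : H) :
    Integrable fun η : ℝ ↦ (inner ℂ φ (cfc (fun x : ℝ ↦ |x| / (x ^ 2 + η ^ 2)) D φ)).re :=
  (((hD.integrable_cfc_abs_div hδ hs).apply_continuousLinearMap φ).const_inner (𝕜 := ℂ) φ).re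

lemma integral_re_inner_cfc_abs_div (hD : IsSelfAdjoint D) (hδ : 0 < δ)
    (hs : ∀ x ∈ spectrum ℝ D, δ ≤ |x|) (φ : H) :
    ∫ η : ℝ, (inner ℂ φ (cfc (fun x : ℝ ↦ |x| / (x ^ 2 + η ^ 2)) D φ)).re =
      Real.pi * ‖φ‖ ^ 2 := by
  have hint := hD.integrable_cfc_abs_div hδ hs
  have hre := integral_re ((hint.apply_continuousLinearMap φ).const_inner (𝕜 := ℂ) φ)
  refine hre.trans ?_
  rw [integral_inner (hint.apply_continuousLinearMap φ),
    ← ContinuousLinearMap.integral_apply hint, hD.integral_cfc_abs_div hδ hs]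
  simp [← Complex.coe_smul, inner_smul_right, ← ofReal_pow]

lemma norm_cfc_sqrt_abs_sq_le (hD : IsSelfAdjoint D) (hδ : 0 < δ)
    (hs : ∀ x ∈ spectrum ℝ D, δ ≤ |x|) {K : H →L[ℂ] H} {κ : ℝ} (hK : ‖K‖ ≤ κ) (hκ : κ < δ)
    (η : ℝ) {φ ψ : H} (hψ : (D + K - ((η : ℂ) * I) • (1 : H →L[ℂ] H)) ψ = φ) :
    ‖cfc (fun x : ℝ ↦ √|x|) D ψ‖ ^ 2 ≤
      2 * (inner ℂ φ (cfc (fun x : ℝ ↦ |x| / (x ^ 2 + η ^ 2)) D φ)).re +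
        2 * (κ ^ 2 / (δ - κ) ^ 2 * ‖φ‖ ^ 2) * (δ / (δ ^ 2 + η ^ 2)) := by
  have hκ0 : 0 ≤ κ := (norm_nonneg K).trans hK
  have hcont : ContinuousOn (fun x : ℝ ↦ |x| / (x ^ 2 + η ^ 2)) (spectrum ℝ D) :=
    ContinuousOn.div (by fun_prop) (by fun_prop) fun x hx ↦
      (sq_add_sq_pos_of_le_abs hδ (hs x hx) η).ne'
  have hsplit : (D - ((η : ℂ) * I) • (1 : H →L[ℂ] H)) ψ = φ - K ψ := by
    simp only [← hψ, sub_apply, add_apply]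
    abel
  have habs : cfc (fun x : ℝ ↦ |x|) D =
      cfc (fun x : ℝ ↦ |x| / (x ^ 2 + η ^ 2) * (x ^ 2 + η ^ 2)) D :=
    cfc_congr fun x hx ↦
      (div_mul_cancel₀ _ (sq_add_sq_pos_of_le_abs hδ (hs x hx) η).ne').symm
  have hpos : (cfc (fun x : ℝ ↦ |x| / (x ^ 2 + η ^ 2)) D).IsPositive := by
    rw [← ContinuousLinearMap.nonneg_iff_isPositive]
    exact cfc_nonneg fun x _ ↦ by positivity
  rw [norm_cfc_sqrt_abs_sq, habs, ← hD.inner_sub_smul_cfc η hcont, hsplit]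
  refine (hpos.re_inner_sub_le φ (K ψ)).trans ?_
  have hK2 : (inner ℂ (K ψ) (cfc (fun x : ℝ ↦ |x| / (x ^ 2 + η ^ 2)) D (K ψ))).re ≤
      δ⁻¹ * ‖K ψ‖ ^ 2 := by
    refine re_inner_cfc_le D (by positivity) (fun x hx ↦ ?_) _
    have hx' := hs x hx
    have hx0 : 0 < |x| := hδ.trans_le hx'
    rw [abs_of_nonneg (by positivity), ← sq_abs x]
    calc |x| / (|x| ^ 2 + η ^ 2) ≤ |x| / |x| ^ 2 := by
          gcongr
          exact le_add_of_nonneg_right (sq_nonneg η)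
      _ = |x|⁻¹ := by field_simp
      _ ≤ δ⁻¹ := by gcongr
  have hψ2 := hD.norm_sq_le_of_add_sub_smul_one hδ hs hK hκ η ψ
  rw [hψ] at hψ2
  have hKψ : ‖K ψ‖ ^ 2 ≤ κ ^ 2 * ‖ψ‖ ^ 2 := by
    rw [← mul_pow]
    gcongr
    exact K.le_of_opNorm_le hK ψ
  have hδκ : 0 < δ - κ := sub_pos.mpr hκ
  have hlast : δ⁻¹ * ‖K ψ‖ ^ 2 ≤ κ ^ 2 / (δ - κ) ^ 2 * ‖φ‖ ^ 2 * (δ / (δ ^ 2 + η ^ 2)) := by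
    calc δ⁻¹ * ‖K ψ‖ ^ 2
        ≤ δ⁻¹ * (κ ^ 2 * (δ ^ 2 / (δ - κ) ^ 2 * (δ ^ 2 + η ^ 2)⁻¹ * ‖φ‖ ^ 2)) := by
          gcongr
          exact hKψ.trans (by gcongr)
      _ = κ ^ 2 / (δ - κ) ^ 2 * ‖φ‖ ^ 2 * (δ / (δ ^ 2 + η ^ 2)) := by field_simp
  linarith

end IsSelfAdjoint

end Resolvent

/-- Let `δ > 0` and `0 ≤ κ < δ`. There is `C = C(δ, κ) > 0` such that for
every complex Hilbert space `H`, every bounded self-adjoint `D` with spectrum disjoint from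
`(−δ, δ)` and every bounded `K` with `‖K‖ ≤ κ`: `D + K − iη` is invertible for all `η ∈ ℝ`,
and `∫_ℝ ‖ |D|^{1/2} (D + K − iη)⁻¹ φ ‖² dη ≤ C ‖φ‖²` for all `φ ∈ H`. -/
theorem exists_uniform_square_integral_bound
    (δ κ : ℝ) (hδ : 0 < δ) (hκ0 : 0 ≤ κ) (hκδ : κ < δ) :
    ∃ C : ℝ, 0 < C ∧
      ∀ (H : Type) [NormedAddCommGroup H] [InnerProductSpace ℂ H] [CompleteSpace H]
        (D K : H →L[ℂ] H), IsSelfAdjoint D →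
        (∀ x ∈ spectrum ℝ D, x ∉ Set.Ioo (-δ) δ) → ‖K‖ ≤ κ →
        (∀ η : ℝ, IsUnit (D + K - ((η : ℂ) * Complex.I) • (1 : H →L[ℂ] H))) ∧
        ∀ φ : H,
          ∫ η : ℝ,
              ‖cfc (fun x : ℝ => Real.sqrt |x|) D
                (Ring.inverse (D + K - ((η : ℂ) * Complex.I) • (1 : H →L[ℂ] H)) φ)‖ ^ 2
            ≤ C * ‖φ‖ ^ 2 := by
  have hδκ : 0 < δ - κ := sub_pos.mpr hκδ
  refine ⟨2 * Real.pi * (1 + κ ^ 2 / (δ - κ) ^ 2), by positivity, ?_⟩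
  intro H _ _ _ D K hD hspec hK
  have hs : ∀ x ∈ spectrum ℝ D, δ ≤ |x| := fun x hx ↦ by
    simpa [Set.mem_Ioo, ← abs_lt] using hspec x hx
  have hunit := hD.isUnit_add_sub_smul_one hδ hs (hK.trans_lt hκδ)
  refine ⟨hunit, fun φ ↦ ?_⟩
  have hint₁ := (hD.integrable_re_inner_cfc_abs_div hδ hs φ).const_mul 2
  have hint₂ := (integrable_div_sq_add_sq hδ).const_mul (2 * (κ ^ 2 / (δ - κ) ^ 2 * ‖φ‖ ^ 2))
  refine (integral_mono_of_nonneg (.of_forall fun η ↦ by positivity) (hint₁.add hint₂)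
    (.of_forall fun η ↦ ?_)).trans_eq ?_
  · refine hD.norm_cfc_sqrt_abs_sq_le hδ hs hK hκδ η ?_
    rw [← mul_apply_eq_comp, Ring.mul_inverse_cancel _ (hunit η),
      one_apply_eq_self]
  · rw [integral_add' hint₁ hint₂, integral_const_mul, integral_const_mul,
      hD.integral_re_inner_cfc_abs_div hδ hs, integral_univ_div_sq_add_sq hδ]
    ring
end

section
/- Let H be a complex Hilbert space, δ > 0, and let D and K be bounded self-adjoint operators on H such that the spectra of both D and D + K are disjoint from the open interval (−δ, δ). Then ‖ sgn(D + K) − sgn(D) ‖ ≤ ‖K‖ / δ; consequently the positive spectral projections Λ⁺_{D+K} := (1/2)(1 + sgn(D + K)) and Λ⁺_D := (1/2)(1 + sgn(D)) satisfy ‖ Λ⁺_{D+K} − Λ⁺_D ‖ ≤ ‖K‖ / (2δ). -/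
open Filter Topology

/-- If `1 - ε • a` and `1 - ε • b` have norm at most `1 - ε * δ` for all small `ε > 0`, then the
Sylvester operator `x ↦ a * x + x * b` is bounded below by `2 * δ`. -/
theorem two_mul_norm_le_norm_mul_add_mul {A : Type*} [NormedRing A] [NormedAlgebra ℝ A]
    {δ : ℝ} {a b : A} (ha : ∀ᶠ ε : ℝ in 𝓝[>] 0, ‖1 - ε • a‖ ≤ 1 - ε * δ)
    (hb : ∀ᶠ ε : ℝ in 𝓝[>] 0, ‖1 - ε • b‖ ≤ 1 - ε * δ) (x : A) :
    2 * δ * ‖x‖ ≤ ‖a * x + x * b‖ := by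
  have key : ∀ᶠ ε : ℝ in 𝓝[>] 0,
      2 * δ * ‖x‖ ≤ ‖a * x + x * b‖ + ε * (δ ^ 2 * ‖x‖ + ‖a * x * b‖) := by
    filter_upwards [ha, hb, self_mem_nhdsWithin] with ε hεa hεb hε
    have hε : 0 < ε := hε
    have hx : x = (1 - ε • a) * x * (1 - ε • b) + ε • (a * x + x * b)
        - ε ^ 2 • (a * x * b) := by
      simp only [sub_mul, mul_sub, one_mul, mul_one, smul_mul_assoc, mul_smul_comm, smul_add,
        smul_sub, smul_smul, pow_two]
      abel
    have hprod : ‖(1 - ε • a) * x * (1 - ε • b)‖ ≤ (1 - ε * δ) * ‖x‖ * (1 - ε * δ) := by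
      have h0 : 0 ≤ 1 - ε * δ := (norm_nonneg _).trans hεa
      refine (norm_mul_le _ _).trans ?_
      gcongr
      refine (norm_mul_le _ _).trans ?_
      gcongr
    have hnorm : ‖x‖ ≤ (1 - ε * δ) * ‖x‖ * (1 - ε * δ) + ε * ‖a * x + x * b‖
        + ε ^ 2 * ‖a * x * b‖ := by
      calc ‖x‖ = ‖(1 - ε • a) * x * (1 - ε • b) + ε • (a * x + x * b)
            - ε ^ 2 • (a * x * b)‖ := by rw [← hx]
        _ ≤ ‖(1 - ε • a) * x * (1 - ε • b)‖ + ‖ε • (a * x + x * b)‖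
            + ‖ε ^ 2 • (a * x * b)‖ :=
          (norm_sub_le _ _).trans (by gcongr; exact norm_add_le _ _)
        _ ≤ _ := by
          rw [norm_smul_of_nonneg hε.le, norm_smul_of_nonneg (by positivity : 0 ≤ ε ^ 2)]
          gcongr
    refine le_of_mul_le_mul_left ?_ hε
    linarith
  have hlim : Tendsto (fun ε : ℝ => ‖a * x + x * b‖ + ε * (δ ^ 2 * ‖x‖ + ‖a * x * b‖))
      (𝓝[>] 0) (𝓝 ‖a * x + x * b‖) := by
    refine Tendsto.mono_left ?_ nhdsWithin_le_nhds
    refine Continuous.tendsto' (by fun_prop) _ _ (by simp)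
  exact ge_of_tendsto hlim key

section CStarAlgebra

variable {A : Type*} [CStarAlgebra A] {δ : ℝ} {a : A}

/-- The sign function is continuous on the spectrum of an element whose spectrum avoids `0`. -/
theorem continuousOn_sign_spectrum (ha : ∀ x ∈ spectrum ℝ a, x ≠ 0) :
    ContinuousOn Real.sign (spectrum ℝ a) := by
  intro x hx
  refine ContinuousAt.continuousWithinAt ?_
  rcases lt_or_gt_of_ne (ha x hx) with h | h
  · refine (continuousAt_const (y := (-1 : ℝ))).congr ?_
    filter_upwards [Iio_mem_nhds h] with y hy using (Real.sign_of_neg hy).symm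
  · refine (continuousAt_const (y := (1 : ℝ))).congr ?_
    filter_upwards [Ioi_mem_nhds h] with y hy using (Real.sign_of_pos hy).symm

theorem norm_cfc_sign_le_one (a : A) : ‖cfc Real.sign a‖ ≤ 1 := by
  refine norm_cfc_le zero_le_one fun x _ => ?_
  rcases Real.sign_apply_eq x with h | h | h <;> simp [h]

theorem cfc_sign_mul_self (h : IsSelfAdjoint a) (ha : ∀ x ∈ spectrum ℝ a, x ≠ 0) :
    cfc Real.sign a * cfc Real.sign a = 1 := by
  have hc := continuousOn_sign_spectrum ha
  rw [← cfc_mul Real.sign Real.sign a hc hc, ← cfc_one ℝ a]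
  refine cfc_congr fun x hx => ?_
  rcases lt_or_gt_of_ne (ha x hx) with h | h
  · simp [Real.sign_of_neg h]
  · simp [Real.sign_of_pos h]

theorem cfc_sign_mul (h : IsSelfAdjoint a) (ha : ∀ x ∈ spectrum ℝ a, x ≠ 0) :
    cfc Real.sign a * a = cfc (fun x : ℝ => |x|) a := by
  have hc := continuousOn_sign_spectrum ha
  nth_rw 2 [← cfc_id' ℝ a]
  rw [← cfc_mul Real.sign (fun x => x) a hc]
  refine cfc_congr fun x _ => ?_
  rcases lt_trichotomy x 0 with h | rfl | h
  · simp [Real.sign_of_neg h, abs_of_neg h]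
  · simp
  · simp [Real.sign_of_pos h, abs_of_pos h]

theorem mul_cfc_sign (h : IsSelfAdjoint a) (ha : ∀ x ∈ spectrum ℝ a, x ≠ 0) :
    a * cfc Real.sign a = cfc (fun x : ℝ => |x|) a := by
  rw [← cfc_sign_mul h ha]
  have hcomm := (cfc_commute_cfc (fun x : ℝ => x) Real.sign a).eq
  rwa [cfc_id' ℝ a] at hcomm

theorem eventually_norm_one_sub_smul_cfc_abs_le (h : IsSelfAdjoint a)
    (ha : ∀ x ∈ spectrum ℝ a, δ ≤ |x|) :
    ∀ᶠ ε : ℝ in 𝓝[>] 0, ‖1 - ε • cfc (fun x : ℝ => |x|) a‖ ≤ 1 - ε * δ := by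
  have hlim : Tendsto (fun ε : ℝ => ε * max δ (‖a‖ * ‖(1 : A)‖)) (𝓝[>] 0) (𝓝 0) :=
    (Continuous.tendsto' (by fun_prop) _ _ (by simp)).mono_left nhdsWithin_le_nhds
  filter_upwards [hlim.eventually (gt_mem_nhds one_pos), self_mem_nhdsWithin] with ε hε1 hε
  have hε : 0 < ε := hε
  have hbound : ∀ y ≤ max δ (‖a‖ * ‖(1 : A)‖), ε * y ≤ 1 := fun y hy =>
    (mul_le_mul_of_nonneg_left hy hε.le).trans hε1.le
  have heq : 1 - ε • cfc (fun x : ℝ => |x|) a = cfc (fun x : ℝ => 1 - ε * |x|) a := by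
    rw [cfc_sub (fun _ => 1) (fun x : ℝ => ε * |x|) a, cfc_const_one ℝ a,
      cfc_const_mul ε (fun x : ℝ => |x|) a]
  rw [heq]
  refine norm_cfc_le (sub_nonneg.2 (hbound δ (le_max_left _ _))) fun x hx => ?_
  have hx1 := hbound |x| ((spectrum.norm_le_norm_mul_of_mem hx).trans (le_max_right _ _))
  rw [Real.norm_of_nonneg (by linarith)]
  have := mul_le_mul_of_nonneg_left (ha x hx) hε.le
  linarith

/-- The sign function is Lipschitz with constant `δ⁻¹` on the selfadjoint elements whose spectrum
avoids `(-δ, δ)`. -/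
theorem norm_cfc_sign_sub_cfc_sign_le {b : A} (hδ : 0 < δ)
    (ha : IsSelfAdjoint a) (hb : IsSelfAdjoint b)
    (hspeca : ∀ x ∈ spectrum ℝ a, δ ≤ |x|) (hspecb : ∀ x ∈ spectrum ℝ b, δ ≤ |x|) :
    ‖cfc Real.sign b - cfc Real.sign a‖ ≤ ‖b - a‖ / δ := by
  have ha0 : ∀ x ∈ spectrum ℝ a, x ≠ 0 := fun x hx => abs_pos.1 (hδ.trans_le (hspeca x hx))
  have hb0 : ∀ x ∈ spectrum ℝ b, x ≠ 0 := fun x hx => abs_pos.1 (hδ.trans_le (hspecb x hx))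
  set p := cfc Real.sign b with hp
  set q := cfc Real.sign a with hq
  have hpp : p * p = 1 := cfc_sign_mul_self hb hb0
  have hqq : q * q = 1 := cfc_sign_mul_self ha ha0
  have hsylv : cfc (fun x : ℝ => |x|) b * (p - q) + (p - q) * cfc (fun x : ℝ => |x|) a
      = (b - a) - p * (b - a) * q := by
    have h1 : cfc (fun x : ℝ => |x|) b * p = b := by
      rw [← mul_cfc_sign hb hb0, mul_assoc, hpp, mul_one]
    have h2 : q * cfc (fun x : ℝ => |x|) a = a := by
      rw [← cfc_sign_mul ha ha0, ← mul_assoc, hqq, one_mul]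
    have h3 : cfc (fun x : ℝ => |x|) b * q = p * b * q := by rw [← cfc_sign_mul hb hb0]
    have h4 : p * cfc (fun x : ℝ => |x|) a = p * a * q := by
      rw [← mul_cfc_sign ha ha0, mul_assoc]
    rw [mul_sub, sub_mul, h1, h2, h3, h4, mul_sub, sub_mul]
    abel
  have hlower := two_mul_norm_le_norm_mul_add_mul
    (eventually_norm_one_sub_smul_cfc_abs_le hb hspecb)
    (eventually_norm_one_sub_smul_cfc_abs_le ha hspeca) (p - q)
  have hconj : ‖p * (b - a) * q‖ ≤ ‖b - a‖ := by
    calc ‖p * (b - a) * q‖ ≤ ‖p‖ * ‖b - a‖ * ‖q‖ := norm_mul₃_le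
      _ ≤ 1 * ‖b - a‖ * 1 := by
        gcongr
        exacts [norm_cfc_sign_le_one b, norm_cfc_sign_le_one a]
      _ = ‖b - a‖ := by ring
  rw [hsylv] at hlower
  rw [le_div_iff₀ hδ]
  linarith [norm_sub_le (b - a) (p * (b - a) * q)]

end CStarAlgebra

/-- Let `D` and `K` be bounded self-adjoint operators such that the spectra
of both `D` and `D + K` are disjoint from `(−δ, δ)`, `δ > 0`. Then
`‖sgn(D + K) − sgn(D)‖ ≤ ‖K‖/δ`, and consequently the positive spectral projections satisfy
`‖Λ⁺_{D+K} − Λ⁺_D‖ ≤ ‖K‖/(2δ)`. -/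
theorem sgn_difference_bound
    {H : Type*} [NormedAddCommGroup H] [InnerProductSpace ℂ H] [CompleteSpace H]
    (δ : ℝ) (hδ : 0 < δ)
    (D K : H →L[ℂ] H) (hD : IsSelfAdjoint D) (hK : IsSelfAdjoint K)
    (hspecD : ∀ x ∈ spectrum ℝ D, x ∉ Set.Ioo (-δ) δ)
    (hspecDK : ∀ x ∈ spectrum ℝ (D + K), x ∉ Set.Ioo (-δ) δ) :
    ‖cfc Real.sign (D + K) - cfc Real.sign D‖ ≤ ‖K‖ / δ ∧
    ‖(1 / 2 : ℂ) • (1 + cfc Real.sign (D + K))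
        - (1 / 2 : ℂ) • (1 + cfc Real.sign D)‖ ≤ ‖K‖ / (2 * δ) := by
  have hout : ∀ x : ℝ, x ∉ Set.Ioo (-δ) δ → δ ≤ |x| := fun x hx =>
    not_lt.1 fun h => hx (abs_lt.1 h)
  have hsign : ‖cfc Real.sign (D + K) - cfc Real.sign D‖ ≤ ‖K‖ / δ := by
    simpa only [add_sub_cancel_left] using norm_cfc_sign_sub_cfc_sign_le hδ hD (hD.add hK)
      (fun x hx => hout x (hspecD x hx)) (fun x hx => hout x (hspecDK x hx))
  refine ⟨hsign, ?_⟩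
  rw [← smul_sub, add_sub_add_left_eq_sub, norm_smul]
  calc ‖(1 / 2 : ℂ)‖ * ‖cfc Real.sign (D + K) - cfc Real.sign D‖
      ≤ 1 / 2 * (‖K‖ / δ) := by
        gcongr
        norm_num
    _ = ‖K‖ / (2 * δ) := by ring
end
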